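/- Let A be a block matrix over a field 𝔽 with n block rows/columns admitting an SSS representation with dimensions (r^h_i) and (r^g_i), and set r = max over 1 ≤ i ≤ n−1 of max(r^h_i, r^g_i). Let L be the line graph on the n block indices, with edges {k, k+1} for 1 ≤ k ≤ n−1. Then (A, L) is GIRS-r: for every subset S of block indices, rank(A_{S̄,S}) ≤ r·ρ_L(S), where ρ_L(S) is the number of edges of L with exactly one endpoint in S. -/

import Mathlib

open Matrix

variable {𝔽 : Type*} [Field 𝔽]

/-- The product of `d` consecutive transition matrices `W k * W (k+1) * ⋯ * W (k+d-1)`. -/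
def sssChainAux (rg : ℕ → ℕ) (W : ∀ j, Matrix (Fin (rg j)) (Fin (rg (j + 1))) 𝔽) (k : ℕ) :
    (d : ℕ) → Matrix (Fin (rg k)) (Fin (rg (k + d))) 𝔽
  | 0 => (1 : Matrix (Fin (rg k)) (Fin (rg k)) 𝔽)
  | d + 1 => sssChainAux rg W k d * W (k + d)

/-- The product of the transition matrices `W k * W (k+1) * ⋯ * W (ℓ-1)` (the identity when
`k = ℓ`, and junk `0` when `ℓ < k`). -/
def sssChain (rg : ℕ → ℕ) (W : ∀ j, Matrix (Fin (rg j)) (Fin (rg (j + 1))) 𝔽) (k ℓ : ℕ) :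
    Matrix (Fin (rg k)) (Fin (rg ℓ)) 𝔽 :=
  if h : k ≤ ℓ then Nat.add_sub_cancel' h ▸ sssChainAux rg W k (ℓ - k) else 0

/-- A sequentially semi-separable (SSS) representation of a block matrix `A` (with `n` block
rows/columns, block `k` of size `N k`, blocks indexed from `0`) with dimensions `rg`, `rh`
(`rg c`, `rh c` being the state dimensions at the cut between blocks `c` and `c + 1`, for
`0 ≤ c ≤ n - 2`): the diagonal blocks of `A` are `D k`; the strictly upper blocks are
`A_{k ℓ} = U k * W k * W (k+1) * ⋯ * W (ℓ - 2) * (V ℓ)ᵀ` for `k < ℓ`; and the strictly lower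
blocks are `A_{k ℓ} = P k * R (k-2) * R (k-3) * ⋯ * R ℓ * (Q ℓ)ᵀ` for `ℓ < k`. -/
def IsSSSRep {n : ℕ} (N : ℕ → ℕ)
    (A : Matrix ((k : Fin n) × Fin (N k)) ((k : Fin n) × Fin (N k)) 𝔽)
    (rg rh : ℕ → ℕ)
    (U : ∀ k, Matrix (Fin (N k)) (Fin (rg k)) 𝔽)
    (W : ∀ j, Matrix (Fin (rg j)) (Fin (rg (j + 1))) 𝔽)
    (V : ∀ k, Matrix (Fin (N k)) (Fin (rg (k - 1))) 𝔽)
    (D : ∀ k, Matrix (Fin (N k)) (Fin (N k)) 𝔽)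
    (P : ∀ k, Matrix (Fin (N k)) (Fin (rh (k - 1))) 𝔽)
    (R : ∀ j, Matrix (Fin (rh (j + 1))) (Fin (rh j)) 𝔽)
    (Q : ∀ k, Matrix (Fin (N k)) (Fin (rh k)) 𝔽) : Prop :=
  (∀ (k : Fin n) (i j : Fin (N k)), A ⟨k, i⟩ ⟨k, j⟩ = D k i j) ∧
  (∀ (k ℓ : Fin n), (k : ℕ) < (ℓ : ℕ) → ∀ (i : Fin (N k)) (j : Fin (N ℓ)),
      A ⟨k, i⟩ ⟨ℓ, j⟩ = (U k * sssChain rg W k ((ℓ : ℕ) - 1) * (V ℓ)ᵀ) i j) ∧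
  (∀ (k ℓ : Fin n), (ℓ : ℕ) < (k : ℕ) → ∀ (i : Fin (N k)) (j : Fin (N ℓ)),
      A ⟨k, i⟩ ⟨ℓ, j⟩ =
        (P k * (sssChain rh (fun j => (R j)ᵀ) ℓ ((k : ℕ) - 1))ᵀ * (Q ℓ)ᵀ) i j)

/-- The lower Hankel block `𝓗` at cut `c`: rows in blocks `{c+1, …, n-1}`, columns in blocks
`{0, …, c}`. -/
def lowerHankelBlock {n : ℕ} (N : ℕ → ℕ)
    (A : Matrix ((k : Fin n) × Fin (N k)) ((k : Fin n) × Fin (N k)) 𝔽) (c : ℕ) :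
    Matrix {p : (k : Fin n) × Fin (N k) // c < (p.1 : ℕ)}
      {p : (k : Fin n) × Fin (N k) // (p.1 : ℕ) ≤ c} 𝔽 :=
  Matrix.of fun i j => A i.1 j.1

/-- The upper Hankel block `𝓖` at cut `c`: rows in blocks `{0, …, c}`, columns in blocks
`{c+1, …, n-1}`. -/
def upperHankelBlock {n : ℕ} (N : ℕ → ℕ)
    (A : Matrix ((k : Fin n) × Fin (N k)) ((k : Fin n) × Fin (N k)) 𝔽) (c : ℕ) :
    Matrix {p : (k : Fin n) × Fin (N k) // (p.1 : ℕ) ≤ c}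
      {p : (k : Fin n) × Fin (N k) // c < (p.1 : ℕ)} 𝔽 :=
  Matrix.of fun i j => A i.1 j.1

/-- The Hankel block `A_{S̄,S}` of a block matrix for a subset `S` of block indices. -/
def blockHankel {n : ℕ} (N : ℕ → ℕ)
    (A : Matrix ((k : Fin n) × Fin (N k)) ((k : Fin n) × Fin (N k)) 𝔽) (S : Finset (Fin n)) :
    Matrix {p : (k : Fin n) × Fin (N k) // p.1 ∉ S}
      {p : (k : Fin n) × Fin (N k) // p.1 ∈ S} 𝔽 :=
  Matrix.of fun i j => A i.1 j.1

/-- `ρ_L(S)` for the line graph on `Fin n` with edges `{k, k+1}`: the number of edges with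
exactly one endpoint in `S`. -/
def lineBorder (n : ℕ) (S : Finset (Fin n)) : ℕ :=
  (Finset.univ.filter fun p : Fin n × Fin n =>
    (p.1 : ℕ) + 1 = (p.2 : ℕ) ∧ ¬((p.1 ∈ S) ↔ (p.2 ∈ S))).card

lemma sssChain_self (rg : ℕ → ℕ) (W : ∀ j, Matrix (Fin (rg j)) (Fin (rg (j + 1))) 𝔽) (k : ℕ) :
    sssChain rg W k k = 1 := by
  have aux : ∀ (d : ℕ) (h : k + d = k), d = 0 → h ▸ sssChainAux rg W k d = 1 := by
    rintro d h rfl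
    rfl
  rw [sssChain, dif_pos le_rfl]
  exact aux _ _ (Nat.sub_self k)

lemma sssChain_add (rg : ℕ → ℕ) (W : ∀ j, Matrix (Fin (rg j)) (Fin (rg (j + 1))) 𝔽) (k d : ℕ) :
    sssChain rg W k (k + d) = sssChainAux rg W k d := by
  have aux : ∀ (e : ℕ) (h : k + e = k + d), e = d →
      h ▸ sssChainAux rg W k e = sssChainAux rg W k d := by
    rintro e h rfl
    rfl
  rw [sssChain, dif_pos (Nat.le_add_right k d)]
  exact aux _ _ (Nat.add_sub_cancel_left ..)

lemma sssChain_succ (rg : ℕ → ℕ) (W : ∀ j, Matrix (Fin (rg j)) (Fin (rg (j + 1))) 𝔽) {k ℓ : ℕ}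
    (h : k ≤ ℓ) : sssChain rg W k (ℓ + 1) = sssChain rg W k ℓ * W ℓ := by
  obtain ⟨d, rfl⟩ := Nat.exists_eq_add_of_le h
  rw [sssChain_add]
  exact sssChain_add rg W k (d + 1)

lemma sssChain_mul (rg : ℕ → ℕ) (W : ∀ j, Matrix (Fin (rg j)) (Fin (rg (j + 1))) 𝔽) {k ℓ m : ℕ}
    (hkl : k ≤ ℓ) (hlm : ℓ ≤ m) :
    sssChain rg W k m = sssChain rg W k ℓ * sssChain rg W ℓ m := by
  induction m, hlm using Nat.le_induction with
  | base => rw [sssChain_self, Matrix.mul_one]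
  | succ m hlm ih =>
    rw [sssChain_succ rg W (hkl.trans hlm), sssChain_succ rg W hlm, ih, Matrix.mul_assoc]

/-- A matrix supported on a product of row and column sets, where its entries are inner products
of length `d`, has rank at most `d`. -/
lemma Matrix.rank_le_of_masked_mul {ι κ : Type*} [Fintype κ] {d : ℕ} (M : Matrix ι κ 𝔽)
    (p : ι → Prop) (q : κ → Prop) (X : ι → Fin d → 𝔽) (Y : Fin d → κ → 𝔽)
    (hM : ∀ i j, p i → q j → M i j = ∑ a, X i a * Y a j)
    (h0 : ∀ i j, ¬(p i ∧ q j) → M i j = 0) : M.rank ≤ d := by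
  classical
  have hfac : M = (Matrix.of fun i a => if p i then X i a else 0) *
      (Matrix.of fun a j => if q j then Y a j else 0) := by
    ext i j
    by_cases hp : p i <;> by_cases hq : q j <;> simp [Matrix.mul_apply, hp, hq, hM, h0]
  rw [hfac]
  refine (Matrix.rank_mul_le_left _ _).trans ((Matrix.rank_le_card_width _).trans ?_)
  rw [Fintype.card_fin]

lemma Matrix.rank_add_le {ι κ : Type*} [Fintype κ] (M M' : Matrix ι κ 𝔽) :
    (M + M').rank ≤ M.rank + M'.rank := by
  rw [Matrix.rank, Matrix.rank, Matrix.rank, Matrix.mulVecLin_add]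
  refine (Submodule.finrank_mono ?_).trans (Submodule.finrank_add_le_finrank_add_finrank _ _)
  exact LinearMap.range_add_le _ _

lemma Matrix.rank_sum_le_card_mul {α ι κ : Type*} [Fintype κ] (s : Finset α)
    (M : α → Matrix ι κ 𝔽) (d : ℕ) (h : ∀ a ∈ s, (M a).rank ≤ d) :
    (∑ a ∈ s, M a).rank ≤ d * s.card := by
  classical
  induction s using Finset.induction_on with
  | empty => simp
  | insert a s ha ih =>
    rw [Finset.sum_insert ha, Finset.card_insert_of_notMem ha, mul_add_one, add_comm (M a)]
    refine (Matrix.rank_add_le _ _).trans (add_le_add ?_ ?_)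
    · exact ih fun b hb => h b (Finset.mem_insert_of_mem hb)
    · exact h a (Finset.mem_insert_self a s)

/-- The edge `{c, c + 1}` of the line graph is the first border edge of `S` met when walking from
the block `k` towards the block `ℓ`. -/
def IsFirstBorder {n : ℕ} (S : Finset (Fin n)) (c k ℓ : Fin n) : Prop :=
  (c ∈ S ∧ (c < k ∧ ∀ x, c < x → x ≤ k → x ∉ S) ∧ ℓ ≤ c) ∨
    (c ∉ S ∧ (k ≤ c ∧ ∀ x, k ≤ x → x ≤ c → x ∉ S) ∧ c < ℓ)

lemma existsUnique_isFirstBorder {n : ℕ} (S : Finset (Fin n)) {k ℓ : Fin n} (hk : k ∉ S)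
    (hl : ℓ ∈ S) :
    ∃! p : Fin n × Fin n, ((p.1 : ℕ) + 1 = (p.2 : ℕ) ∧ ¬((p.1 ∈ S) ↔ (p.2 ∈ S))) ∧
      IsFirstBorder S p.1 k ℓ := by
  have hne : k ≠ ℓ := fun h => hk (h ▸ hl)
  rcases lt_or_gt_of_ne hne with hlt | hlt
  · obtain ⟨m, ⟨hkm, hm⟩, hmin⟩ :=
      WellFounded.has_min (wellFounded_lt (α := Fin n)) {x | k < x ∧ x ∈ S} ⟨ℓ, hlt, hl⟩
    have hmin' (x : Fin n) (hkx : k ≤ x) (hx : x < m) : x ∉ S := fun hxS =>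
      hmin x ⟨lt_of_le_of_ne hkx fun h => hk (h ▸ hxS), hxS⟩ hx
    have hml : m ≤ ℓ := not_lt.1 fun h => hmin' ℓ hlt.le h hl
    refine ⟨(⟨m - 1, by lia⟩, m), ⟨⟨by grind, ?_⟩, .inr ⟨?_, ⟨?_, ?_⟩, ?_⟩⟩, ?_⟩
    · have := hmin' ⟨m - 1, by lia⟩ (by grind) (by grind)
      tauto
    · exact hmin' _ (by grind) (by grind)
    · grind
    · exact fun x hkx hx => hmin' x hkx (by grind)
    · grind
    · rintro ⟨c, d⟩ ⟨⟨hcd, hb⟩, ⟨hc, ⟨hck, -⟩, hlc⟩ | ⟨hc, ⟨hkc, hall⟩, hcl⟩⟩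
      · exact absurd (hlt.trans_le (hlc.trans hck.le)) (lt_irrefl _)
      · have hd : d ∈ S := by tauto
        have hmd : ¬ d < m := fun h => hmin' d (by grind) h hd
        have hcm : c < m := not_le.1 fun h => hall m hkm.le h hm
        grind
  · obtain ⟨m, ⟨hkm, hm⟩, hmax⟩ :=
      WellFounded.has_min (wellFounded_gt (α := Fin n)) {x | x < k ∧ x ∈ S} ⟨ℓ, hlt, hl⟩
    have hmax' (x : Fin n) (hkx : x ≤ k) (hx : m < x) : x ∉ S := fun hxS =>
      hmax x ⟨lt_of_le_of_ne hkx fun h => hk (h ▸ hxS), hxS⟩ hx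
    have hlm : ℓ ≤ m := not_lt.1 fun h => hmax' ℓ hlt.le h hl
    refine ⟨(m, ⟨m + 1, by lia⟩), ⟨⟨rfl, ?_⟩, .inl ⟨hm, ⟨hkm, ?_⟩, hlm⟩⟩, ?_⟩
    · have := hmax' ⟨m + 1, by lia⟩ (by grind) (by grind)
      tauto
    · exact fun x hx hkx => hmax' x hkx hx
    · rintro ⟨c, d⟩ ⟨⟨hcd, hb⟩, ⟨hc, ⟨hck, hall⟩, hlc⟩ | ⟨hc, ⟨hkc, -⟩, hcl⟩⟩
      · have hmc : ¬ m < c := fun h => hmax' c hck.le h hc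
        have hcm : ¬ c < m := fun h => hall m h hkm.le hm
        grind
      · exact absurd (hlt.trans_le (hkc.trans hcl.le)) (lt_irrefl _)

/-- If `A` admits an SSS representation with dimensions `rh`, `rg`, and
`r` is the maximum of all these dimensions, then `(A, L)` is GIRS-`r` for the line graph `L`
on the `n` block indices: `rank(A_{S̄,S}) ≤ r · ρ_L(S)` for every subset `S` of block
indices. -/
theorem sss_isGIRS_line {n : ℕ} (N : ℕ → ℕ)
    (A : Matrix ((k : Fin n) × Fin (N k)) ((k : Fin n) × Fin (N k)) 𝔽)
    (rg rh : ℕ → ℕ)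
    (U : ∀ k, Matrix (Fin (N k)) (Fin (rg k)) 𝔽)
    (W : ∀ j, Matrix (Fin (rg j)) (Fin (rg (j + 1))) 𝔽)
    (V : ∀ k, Matrix (Fin (N k)) (Fin (rg (k - 1))) 𝔽)
    (D : ∀ k, Matrix (Fin (N k)) (Fin (N k)) 𝔽)
    (P : ∀ k, Matrix (Fin (N k)) (Fin (rh (k - 1))) 𝔽)
    (R : ∀ j, Matrix (Fin (rh (j + 1))) (Fin (rh j)) 𝔽)
    (Q : ∀ k, Matrix (Fin (N k)) (Fin (rh k)) 𝔽)
    (h : IsSSSRep N A rg rh U W V D P R Q) :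
    ∀ S : Finset (Fin n),
      (blockHankel N A S).rank ≤
        ((Finset.range (n - 1)).sup fun c => max (rh c) (rg c)) * lineBorder n S := by
  classical
  intro S
  obtain ⟨-, hup, hlow⟩ := h
  set E := Finset.univ.filter fun p : Fin n × Fin n =>
    (p.1 : ℕ) + 1 = (p.2 : ℕ) ∧ ¬((p.1 ∈ S) ↔ (p.2 ∈ S)) with hE
  have hsum : blockHankel N A S = ∑ p ∈ E, Matrix.of fun i j =>
      if IsFirstBorder S p.1 i.1.1 j.1.1 then blockHankel N A S i j else 0 := by
    ext i j
    obtain ⟨p, ⟨hpE, hp⟩, huniq⟩ := existsUnique_isFirstBorder S i.2 j.2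
    rw [Matrix.sum_apply, Finset.sum_eq_single p]
    · simp [hp]
    · intro q hq hqp
      have : ¬ IsFirstBorder S q.1 i.1.1 j.1.1 := fun hf =>
        hqp (huniq q ⟨(Finset.mem_filter.1 hq).2, hf⟩)
      simp [this]
    · intro hpn
      exact absurd (Finset.mem_filter.2 ⟨Finset.mem_univ p, hpE⟩) hpn
  rw [hsum]
  refine Matrix.rank_sum_le_card_mul _ _ _ ?_
  rintro ⟨c, c'⟩ hc
  obtain ⟨hcc, -⟩ := (Finset.mem_filter.1 hc).2
  have hmax : max (rh c) (rg c) ≤ (Finset.range (n - 1)).sup fun c => max (rh c) (rg c) :=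
    Finset.le_sup (f := fun c => max (rh c) (rg c)) (Finset.mem_range.2 (by grind))
  by_cases hcS : c ∈ S
  · refine le_trans ?_ ((le_max_left _ _).trans hmax)
    refine Matrix.rank_le_of_masked_mul _
      (fun i => c < i.1.1 ∧ ∀ x, c < x → x ≤ i.1.1 → x ∉ S) (fun j => j.1.1 ≤ c)
      (fun i a => (P i.1.1 * (sssChain rh (fun j => (R j)ᵀ) c ((i.1.1 : ℕ) - 1))ᵀ) i.1.2 a)
      (fun a j => ((sssChain rh (fun j => (R j)ᵀ) j.1.1 c)ᵀ * (Q j.1.1)ᵀ) a j.1.2) ?_ ?_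
    · rintro ⟨⟨k, i⟩, hk⟩ ⟨⟨ℓ, j⟩, hl⟩ hp hq
      have hb : IsFirstBorder S c k ℓ := .inl ⟨hcS, hp, hq⟩
      have hck : (c : ℕ) < k := hp.1
      have hlc : (ℓ : ℕ) ≤ c := hq
      simp only [Matrix.of_apply, hb, if_true, blockHankel]
      rw [hlow k ℓ (hlc.trans_lt hck), sssChain_mul rh _ hlc (Nat.le_sub_one_of_lt hck),
        Matrix.transpose_mul, ← Matrix.mul_assoc, Matrix.mul_assoc, Matrix.mul_apply]
    · intro i j hn
      have hb : ¬ IsFirstBorder S c i.1.1 j.1.1 := by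
        rintro (hb | hb)
        exacts [hn hb.2, hb.1 hcS]
      simp [hb]
  · refine le_trans ?_ ((le_max_right _ _).trans hmax)
    refine Matrix.rank_le_of_masked_mul _
      (fun i => i.1.1 ≤ c ∧ ∀ x, i.1.1 ≤ x → x ≤ c → x ∉ S) (fun j => c < j.1.1)
      (fun i a => (U i.1.1 * sssChain rg W i.1.1 c) i.1.2 a)
      (fun a j => (sssChain rg W c ((j.1.1 : ℕ) - 1) * (V j.1.1)ᵀ) a j.1.2) ?_ ?_
    · rintro ⟨⟨k, i⟩, hk⟩ ⟨⟨ℓ, j⟩, hl⟩ hp hq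
      have hb : IsFirstBorder S c k ℓ := .inr ⟨hcS, hp, hq⟩
      have hkc : (k : ℕ) ≤ c := hp.1
      have hcl : (c : ℕ) < ℓ := hq
      simp only [Matrix.of_apply, hb, if_true, blockHankel]
      rw [hup k ℓ (hkc.trans_lt hcl), sssChain_mul rg W hkc (Nat.le_sub_one_of_lt hcl),
        ← Matrix.mul_assoc, Matrix.mul_assoc, Matrix.mul_apply]
    · intro i j hn
      have hb : ¬ IsFirstBorder S c i.1.1 j.1.1 := by
        rintro (hb | hb)
        exacts [hcS hb.1, hn hb.2]
      simp [hb]
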